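/- Let q = p^ℓ with p > 3 prime, and let f, g : 𝔽_q → 𝔽_q be planar functions such that f(0) ≠ g(0), f(0) = 0, and f(x) = g(x) for all x ≠ 0. Then for every a ∈ 𝔽_q with a ≠ 0, one has f(a) = f(−a). -/

import Mathlib

open Finset

/-- `f : 𝔽_q → 𝔽_q` is planar if for every `a ≠ 0` the difference operator
`Δ_{f,a}(x) = f(x+a) - f(x)` is a bijection of `𝔽_q`. -/
def IsPlanar {F : Type*} [Field F] (f : F → F) : Prop :=
  ∀ a : F, a ≠ 0 → Function.Bijective (fun x => f (x + a) - f x)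

/-- If two planar functions differ exactly at `0` and `f 0 = 0`, then `f a + f (-a)` is the
constant `g 0` on nonzero `a`. -/
theorem IsPlanar.add_apply_neg_eq {F : Type*} [Field F] {f g : F → F} (hf : IsPlanar f)
    (hg : IsPlanar g) (hne : f 0 ≠ g 0) (hf0 : f 0 = 0) (hagree : ∀ x : F, x ≠ 0 → f x = g x)
    {a : F} (ha : a ≠ 0) : f a + f (-a) = g 0 := by
  obtain ⟨x, hx⟩ := (hg a ha).2 (f a)
  simp only at hx
  by_cases hx0 : x = 0
  · subst hx0
    rw [zero_add, ← hagree a ha] at hx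
    exact absurd (hf0.trans (sub_eq_self.mp hx).symm) hne
  by_cases hxa : x + a = 0
  · rw [hxa, ← hagree x hx0, eq_neg_of_add_eq_zero_left hxa] at hx
    rw [← hx, sub_add_cancel]
  · rw [← hagree _ hxa, ← hagree x hx0] at hx
    exact absurd ((hf a ha).1 (by simpa [hf0] using hx)) hx0

/-- A natural number coprime to the prime `p` is nonzero in a field with `p ^ ℓ` elements. -/
theorem FiniteField.natCast_ne_zero_of_coprime {F : Type*} [Field F] [Fintype F] {p ℓ n : ℕ}
    (hq : Fintype.card F = p ^ ℓ) (hn : n.Coprime p) : (n : F) ≠ 0 := by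
  intro h
  have hpow : ((p ^ ℓ : ℕ) : F) = 0 := hq ▸ Nat.cast_card_eq_zero F
  have hdvd := Nat.dvd_gcd (ringChar.dvd h) (ringChar.dvd hpow)
  rw [(hn.pow_right ℓ : n.gcd (p ^ ℓ) = 1)] at hdvd
  exact one_ne_zero (α := F) (by simpa using (ringChar.spec F 1).mpr hdvd)

/-- If `p > 3` and two planar functions agree everywhere except at `0`, where
`f(0) = 0` and `f(0) ≠ g(0)`, then `f(a) = f(-a)` for every `a ≠ 0`. -/
theorem planar_single_diff_symmetry {F : Type*} [Field F] [Fintype F]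
    (p ℓ : ℕ) (hp : p.Prime) (hp3 : 3 < p) (hq : Fintype.card F = p ^ ℓ)
    (f g : F → F) (hf : IsPlanar f) (hg : IsPlanar g)
    (hne : f 0 ≠ g 0) (hf0 : f 0 = 0)
    (hagree : ∀ x : F, x ≠ 0 → f x = g x) :
    ∀ a : F, a ≠ 0 → f a = f (-a) := by
  have h2 : (2 : F) ≠ 0 := mod_cast FiniteField.natCast_ne_zero_of_coprime hq
    ((Nat.coprime_primes Nat.prime_two hp).mpr (by omega))
  have h3 : (3 : F) ≠ 0 := mod_cast FiniteField.natCast_ne_zero_of_coprime hq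
    ((Nat.coprime_primes Nat.prime_three hp).mpr (by omega))
  -- The hypotheses are contradictory: `Δ_{f,1}` takes the same value at `1` and at `-2`.
  have s1 := hf.add_apply_neg_eq hg hne hf0 hagree one_ne_zero
  have s2 := hf.add_apply_neg_eq hg hne hf0 hagree h2
  have hcoll : f (1 + 1) - f 1 = f (-2 + 1) - f (-2) := by
    rw [show (1 : F) + 1 = 2 by norm_num, show (-2 : F) + 1 = -1 by norm_num]
    linear_combination s2 - s1
  have h12 : (1 : F) = -2 := (hf 1 one_ne_zero).1 hcoll
  exact absurd (by linear_combination h12) h3
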